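/- Product rule for numerical elementary weights (Lemma 4.4): Fix s, M ∈ ℕ and real coefficients γ_i^{(q,m)}, Z_{ij}^{(q,m)} (i,j = 1,…,s; q ∈ {1,2}; m ∈ {0,…,M}) satisfying the quadratic-invariant coefficient condition γ_i^{(1,m₁)} γ_j^{(2,m₂)} = γ_j^{(2,m₂)} Z_{ji}^{(1,m₁)} + γ_i^{(1,m₁)} Z_{ij}^{(2,m₂)} for all i,j ∈ {1,…,s} and all m₁,m₂ ∈ {0,…,M}. Define, recursively on shaped colored rooted trees over 2 shapes and M+1 colors, the internal weights Ψ_i(τ) ∈ ℝ and elementary weight Φ(τ) ∈ ℝ by Ψ_i([τ₁,…,τ_κ]_{q,m}) = Σ_{j=1}^s Z_{ij}^{(q,m)} ∏_{k=1}^κ Ψ_j(τ_k) and Φ([τ₁,…,τ_κ]_{q,m}) = Σ_{i=1}^s γ_i^{(q,m)} ∏_{k=1}^κ Ψ_i(τ_k), with empty products equal to 1. Then for every tree u whose root has shape 1 and every tree v whose root has shape 2, Φ(u)·Φ(v) = Φ(u∘v) + Φ(v∘u), where ∘ denotes the Butcher product. -/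

import Mathlib

open BigOperators

/-- Shaped colored rooted trees over `Q` shapes and `M+1` colors. -/
inductive CTree (Q M : ℕ) : Type where
  | node : Fin Q → Fin (M + 1) → List (CTree Q M) → CTree Q M

namespace CTree

/-- The shape of the root of a tree. -/
def shape {Q M : ℕ} : CTree Q M → Fin Q
  | .node q _ _ => q

/-- The Butcher product: `u ∘ v` attaches `v` by a new branch to the root of `u`. -/
def bprod {Q M : ℕ} : CTree Q M → CTree Q M → CTree Q M
  | .node q m cs, v => .node q m (cs ++ [v])

end CTree

mutual
  /-- The internal weights `Ψ_i(τ)` of a stochastic partitioned Runge-Kutta method with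
  coefficients `Z`, defined recursively over trees by
  `Ψ_i([τ₁,…,τ_κ]_{q,m}) = ∑_j Z^{(q,m)}_{ij} ∏_k Ψ_j(τ_k)`. -/
  def Psi {s M : ℕ} (Z : Fin 2 → Fin (M + 1) → Fin s → Fin s → ℝ) :
      CTree 2 M → Fin s → ℝ
    | .node q m cs, i => ∑ j, Z q m i j * PsiProd Z cs j
  /-- The product `∏_k Ψ_j(τ_k)` over a list of trees (empty product `1`). -/
  def PsiProd {s M : ℕ} (Z : Fin 2 → Fin (M + 1) → Fin s → Fin s → ℝ) :
      List (CTree 2 M) → Fin s → ℝ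
    | [], _ => 1
    | c :: cs, j => Psi Z c j * PsiProd Z cs j
end

/-- The elementary weight `Φ(τ)` of a stochastic partitioned Runge-Kutta method with
coefficients `γ`, `Z`: `Φ([τ₁,…,τ_κ]_{q,m}) = ∑_i γ^{(q,m)}_i ∏_k Ψ_i(τ_k)`. -/
def Phi {s M : ℕ} (γ : Fin 2 → Fin (M + 1) → Fin s → ℝ)
    (Z : Fin 2 → Fin (M + 1) → Fin s → Fin s → ℝ) : CTree 2 M → ℝ
  | .node q m cs => ∑ i, γ q m i * PsiProd Z cs i

/-- The weight product over a list extended by one tree. -/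
lemma PsiProd_append_singleton {s M : ℕ} (Z : Fin 2 → Fin (M + 1) → Fin s → Fin s → ℝ)
    (cs : List (CTree 2 M)) (t : CTree 2 M) (i : Fin s) :
    PsiProd Z (cs ++ [t]) i = PsiProd Z cs i * Psi Z t i := by
  induction cs with
  | nil => simp [PsiProd]
  | cons c cs ih => simp [PsiProd, ih, mul_assoc]

/-- Lemma 4.4: if the coefficients of a stochastic partitioned Runge-Kutta method
satisfy the quadratic-invariant condition
`γ^{(1,m₁)}_i γ^{(2,m₂)}_j = γ^{(2,m₂)}_j Z^{(1,m₁)}_{ji} + γ^{(1,m₁)}_i Z^{(2,m₂)}_{ij}`,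
then the elementary weights satisfy the product rule
`Φ(u)·Φ(v) = Φ(u∘v) + Φ(v∘u)` for all trees `u` with root of shape 1 (index `0`)
and `v` with root of shape 2 (index `1`). -/
theorem numerical_elementary_weights_product_rule (s M : ℕ)
    (γ : Fin 2 → Fin (M + 1) → Fin s → ℝ)
    (Z : Fin 2 → Fin (M + 1) → Fin s → Fin s → ℝ)
    (hqi : ∀ (i j : Fin s) (m₁ m₂ : Fin (M + 1)),
      γ 0 m₁ i * γ 1 m₂ j = γ 1 m₂ j * Z 0 m₁ j i + γ 0 m₁ i * Z 1 m₂ i j)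
    (u v : CTree 2 M) (hu : u.shape = 0) (hv : v.shape = 1) :
    Phi γ Z u * Phi γ Z v = Phi γ Z (u.bprod v) + Phi γ Z (v.bprod u) := by
  obtain ⟨q, m, cs⟩ := u
  obtain ⟨r, n, ds⟩ := v
  obtain rfl : q = 0 := hu
  obtain rfl : r = 1 := hv
  simp only [Phi, CTree.bprod, PsiProd_append_singleton, Psi]
  rw [Finset.sum_mul_sum]
  simp only [Finset.mul_sum]
  rw [Finset.sum_comm (f := fun j i =>
    γ 1 n j * (PsiProd Z ds j * (Z 0 m j i * PsiProd Z cs i)))]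
  simp only [← Finset.sum_add_distrib]
  refine Finset.sum_congr rfl fun i _ => Finset.sum_congr rfl fun j _ => ?_
  linear_combination PsiProd Z cs i * PsiProd Z ds j * hqi i j m n
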